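/- Let K ≥ 1 be an integer, γ ∈ (0,1], Π a finite nonempty set of policies, y : Π → {1,…,K} a fixed map, and A : Π → ℝ an arbitrary function. Let D = { (K/γ)·e_i : i ∈ {1,…,K} } ∪ { 0 } ⊂ ℝ^K and let Δ'_D be the set of probability distributions p on D satisfying p( (K/γ)·e_i ) ≤ γ/K for every i ∈ {1,…,K}. Let ε be a one-hot Rademacher random vector in ℝ^K, and let Z take the value K/γ with probability γ and 0 with probability 1−γ, independent of ε. Then sup_{p ∈ Δ'_D} min_{i ∈ {1,…,K}} E_{ĉ ∼ p}[ ĉ(i) + sup_{π ∈ Π} ( A(π) − ĉ(y(π)) ) ] ≤ E_{ε, Z}[ sup_{π ∈ Π} ( 2·Z·ε(y(π)) + A(π) ) ]. -/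

import Mathlib

open Finset

/-- combination of Lemmas 4.5 and 4.6; core inequality behind
the admissibility Theorem 4.1.  A distribution `p ∈ Δ'_D` on
`D = {(K/γ)·e_i : i} ∪ {0}` is parametrized by weights `p i` on the atoms
`(K/γ)·e_i` (with mass `1 - ∑ i, p i` on `0`), constrained by `0 ≤ p i ≤ γ/K`;
the supremum over `p` is expressed by universal quantification.  On the left,
`E_{ĉ∼p}[ĉ(i) + sup_π (A π - ĉ(y π))]` is written out atom by atom and the
minimum over `i ∈ {1,…,K}` is `Finset.inf'`.  On the right, `(ε, Z)` is modeled
on the sample space `(Fin K × Bool) × Bool` with weight `(1/(2K))·(γ or 1-γ)`. -/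
theorem stmt_8 (K : ℕ) (hK : 1 ≤ K) (γ : ℝ) (hγ0 : 0 < γ) (hγ1 : γ ≤ 1)
    (Pol : Type) [Fintype Pol] [Nonempty Pol] (y : Pol → Fin K) (A : Pol → ℝ) :
    ∀ p : Fin K → ℝ, (∀ i, 0 ≤ p i) → (∀ i, p i ≤ γ / K) → (∑ i, p i ≤ 1) →
      (univ.inf' (univ_nonempty_iff.mpr ⟨⟨0, hK⟩⟩) fun i : Fin K =>
          (∑ j : Fin K, p j *
              (((if i = j then (K : ℝ) / γ else 0))
                + univ.sup' univ_nonempty fun π : Pol =>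
                    A π - (K : ℝ) / γ * (if y π = j then 1 else 0)))
            + (1 - ∑ j, p j) * ((0 : ℝ) + univ.sup' univ_nonempty fun π : Pol => A π))
        ≤ ∑ ω : (Fin K × Bool) × Bool,
            ((1 / (2 * (K : ℝ))) * (if ω.2 then γ else 1 - γ)) *
              (univ.sup' univ_nonempty fun π : Pol =>
                2 * (if ω.2 then (K : ℝ) / γ else 0) *
                    (if ω.1.1 = y π then (if ω.1.2 then (1 : ℝ) else -1) else 0) + A π) := by
  intro p hp0 hp1 _
  have hK0 : (0 : ℝ) < K := by exact_mod_cast hK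
  obtain ⟨c, hc⟩ : ∃ c : ℝ, c = K / γ := ⟨_, rfl⟩
  have hc0 : 0 < c := hc ▸ div_pos hK0 hγ0
  obtain ⟨π₀, -, hπ₀⟩ := exists_mem_eq_sup' (univ_nonempty (α := Pol)) A
  have hA : ∀ π, A π ≤ A π₀ := fun π => hπ₀ ▸ le_sup' A (mem_univ π)
  rw [hπ₀, ← hc]
  obtain ⟨F, hF⟩ : ∃ F : Fin K → ℝ, F = fun j => univ.sup' univ_nonempty fun π : Pol =>
      A π - c * (if y π = j then 1 else 0) := ⟨_, rfl⟩
  have hF_le : ∀ j, F j ≤ A π₀ := by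
    intro j
    rw [hF]
    refine sup'_le _ _ fun π _ => ?_
    have := hA π
    split_ifs <;> linarith
  have hF_ge : A π₀ - c ≤ F (y π₀) := by
    rw [hF]
    refine le_sup'_of_le _ (mem_univ π₀) ?_
    simp
  set j₀ := y π₀ with hj₀
  -- the left-hand side is at most its value at the coordinate played by the best policy
  have hL : (∑ j : Fin K, p j * ((if j₀ = j then c else 0) + F j))
      + (1 - ∑ j, p j) * (0 + A π₀) ≤ A π₀ + γ / K * (c + F j₀ - A π₀) := by
    have h1 : ∑ j : Fin K, p j * ((if j₀ = j then c else 0) + F j)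
        ≤ ∑ j : Fin K, (p j * A π₀ + if j₀ = j then γ / K * (c + F j₀ - A π₀) else 0) := by
      refine sum_le_sum fun j _ => ?_
      split_ifs with h
      · subst h
        nlinarith [mul_le_mul_of_nonneg_right (hp1 j₀)
          (by linarith : 0 ≤ c + F j₀ - A π₀)]
      · nlinarith [mul_le_mul_of_nonneg_left (hF_le j) (hp0 j)]
    rw [sum_add_distrib, ← sum_mul, sum_ite_eq] at h1
    simp only [mem_univ, if_true] at h1
    linarith
  refine (inf'_le _ (mem_univ j₀)).trans ?_
  subst hF
  refine hL.trans ?_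
  set f := univ.sup' univ_nonempty fun π : Pol => A π - c * (if y π = j₀ then 1 else 0) with hf
  have hR : ∑ j : Fin K, (A π₀ / K + if j₀ = j then γ / K * (c + f - A π₀) else 0)
      = A π₀ + γ / K * (c + f - A π₀) := by
    rw [sum_add_distrib, sum_ite_eq]
    simp only [mem_univ, if_true, sum_const, card_univ, Fintype.card_fin, nsmul_eq_mul]
    field_simp
  rw [← hR, Fintype.sum_prod_type, Fintype.sum_prod_type]
  refine sum_le_sum fun j _ => ?_
  simp only [Fintype.sum_bool, if_true, Bool.false_eq_true, if_false, mul_zero, zero_mul, zero_add]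
  rw [hπ₀]
  obtain ⟨P, hP⟩ : ∃ P, P = univ.sup' univ_nonempty fun π : Pol =>
      2 * c * (if j = y π then (1 : ℝ) else 0) + A π := ⟨_, rfl⟩
  obtain ⟨N, hN⟩ : ∃ N, N = univ.sup' univ_nonempty fun π : Pol =>
      2 * c * (if j = y π then (-1 : ℝ) else 0) + A π := ⟨_, rfl⟩
  rw [← hP, ← hN]
  have hP' : ∀ π, 2 * c * (if j = y π then (1 : ℝ) else 0) + A π ≤ P := fun π =>
    hP ▸ le_sup' (fun π => 2 * c * (if j = y π then (1 : ℝ) else 0) + A π) (mem_univ π)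
  have hN' : ∀ π, 2 * c * (if j = y π then (-1 : ℝ) else 0) + A π ≤ N := fun π =>
    hN ▸ le_sup' (fun π => 2 * c * (if j = y π then (-1 : ℝ) else 0) + A π) (mem_univ π)
  have key : 2 * A π₀ + (if j₀ = j then 2 * (c + f - A π₀) else 0) ≤ P + N := by
    have hP₀ := hP' π₀
    have hN₀ := hN' π₀
    rw [← hj₀] at hP₀ hN₀
    by_cases h : j₀ = j
    · subst h
      simp only [if_true] at hP₀ ⊢
      -- midpoint convexity of the shifted supremum
      obtain ⟨π₁, -, hπ₁⟩ := exists_mem_eq_sup' (univ_nonempty (α := Pol))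
        fun π => A π - c * (if y π = j₀ then 1 else 0)
      have h1 := hN' π₁
      have h2 := hA π₁
      rw [← hf] at hπ₁
      simp only [eq_comm (a := j₀)] at h1
      split_ifs at h1 hπ₁ <;> linarith
    · rw [if_neg (Ne.symm h)] at hP₀ hN₀
      rw [if_neg h]
      linarith
  have hw := mul_le_mul_of_nonneg_left key (by positivity : 0 ≤ 1 / (2 * (K : ℝ)) * γ)
  have e : A π₀ / K + (if j₀ = j then γ / K * (c + f - A π₀) else 0)
      = 1 / (2 * (K : ℝ)) * γ * (2 * A π₀ + (if j₀ = j then 2 * (c + f - A π₀) else 0))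
        + 2 * (1 / (2 * (K : ℝ)) * (1 - γ) * A π₀) := by
    split_ifs <;> field_simp <;> ring
  rw [e]
  linarith
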